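/- arXiv:1506.05785 — 2 statements merged into one kernel-verified Lean document; each statement's English description precedes it below -/
import Mathlib

section
/- Let U be the submonoid of the quaternions with integer coefficients generated by the set {±1, ±i, ±j, ±k, 1+2i, 1−2i, 1+2j, 1−2j, 1+2k, 1−2k}. Then U equals the set of all integer quaternions p = a + bi + cj + dk whose norm N(p) = a² + b² + c² + d² is a power 5^l of 5 for some integer l ≥ 0. -/
open scoped Quaternion

/-- The norm `N(p) = a² + b² + c² + d²` of an integer quaternion `p = a + bi + cj + dk`. -/
def quatNorm (p : ℍ[ℤ]) : ℤ := p.re ^ 2 + p.imI ^ 2 + p.imJ ^ 2 + p.imK ^ 2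

/-- The quaternion units `i`, `j`, `k`. -/
def qi : ℍ[ℤ] := ⟨0, 1, 0, 0⟩
def qj : ℍ[ℤ] := ⟨0, 0, 1, 0⟩
def qk : ℍ[ℤ] := ⟨0, 0, 0, 1⟩

/-- The generating set `{±1, ±i, ±j, ±k, 1+2i, 1−2i, 1+2j, 1−2j, 1+2k, 1−2k}`. -/
def genSet : Set ℍ[ℤ] :=
  {1, -1, qi, -qi, qj, -qj, qk, -qk,
    1 + 2 * qi, 1 - 2 * qi, 1 + 2 * qj, 1 - 2 * qj, 1 + 2 * qk, 1 - 2 * qk}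

theorem quatNorm_mul (p q : ℍ[ℤ]) : quatNorm (p * q) = quatNorm p * quatNorm q := by
  simp only [quatNorm, Quaternion.re_mul, Quaternion.imI_mul, Quaternion.imJ_mul,
    Quaternion.imK_mul]
  ring

theorem mk_mul_mk (a b c d x y z w : ℤ) :
    (⟨a, b, c, d⟩ * ⟨x, y, z, w⟩ : ℍ[ℤ]) =
      ⟨a * x - b * y - c * z - d * w, a * y + b * x + c * w - d * z,
        a * z - b * w + c * x + d * y, a * w + b * z - c * y + d * x⟩ := by
  refine QuaternionAlgebra.ext ?_ ?_ ?_ ?_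
  · exact Quaternion.re_mul (⟨a, b, c, d⟩ : ℍ[ℤ]) ⟨x, y, z, w⟩
  · exact Quaternion.imI_mul (⟨a, b, c, d⟩ : ℍ[ℤ]) ⟨x, y, z, w⟩
  · exact Quaternion.imJ_mul (⟨a, b, c, d⟩ : ℍ[ℤ]) ⟨x, y, z, w⟩
  · exact Quaternion.imK_mul (⟨a, b, c, d⟩ : ℍ[ℤ]) ⟨x, y, z, w⟩

theorem exists_quatNorm_eq_pow_of_mem_genSet {g : ℍ[ℤ]} (hg : g ∈ genSet) :
    ∃ l : ℕ, quatNorm g = 5 ^ l := by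
  simp only [genSet, Set.mem_insert_iff, Set.mem_singleton_iff] at hg
  rcases hg with rfl | rfl | rfl | rfl | rfl | rfl | rfl | rfl | rfl | rfl | rfl | rfl | rfl | rfl
  iterate 8 exact ⟨0, rfl⟩
  iterate 6 exact ⟨1, rfl⟩

theorem mem_genSet_of_quatNorm_eq_one {p : ℍ[ℤ]} (hp : quatNorm p = 1) : p ∈ genSet := by
  obtain ⟨a, b, c, d⟩ := p
  change a ^ 2 + b ^ 2 + c ^ 2 + d ^ 2 = 1 at hp
  have bounds {x : ℤ} (hx : x ^ 2 ≤ 1) : -1 ≤ x ∧ x ≤ 1 :=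
    abs_le.1 ((sq_le_one_iff_abs_le_one x).1 hx)
  obtain ⟨ha, ha'⟩ := bounds (x := a) (by nlinarith)
  obtain ⟨hb, hb'⟩ := bounds (x := b) (by nlinarith)
  obtain ⟨hc, hc'⟩ := bounds (x := c) (by nlinarith)
  obtain ⟨hd, hd'⟩ := bounds (x := d) (by nlinarith)
  interval_cases a <;> interval_cases b <;> interval_cases c <;> interval_cases d <;>
    first
    | (exfalso; revert hp; norm_num; done)
    | exact (by simp [genSet] : (1 : ℍ[ℤ]) ∈ genSet)
    | exact (by simp [genSet] : (-1 : ℍ[ℤ]) ∈ genSet)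
    | exact (by simp [genSet] : qi ∈ genSet)
    | exact (by simp [genSet] : -qi ∈ genSet)
    | exact (by simp [genSet] : qj ∈ genSet)
    | exact (by simp [genSet] : -qj ∈ genSet)
    | exact (by simp [genSet] : qk ∈ genSet)
    | exact (by simp [genSet] : -qk ∈ genSet)

/-- Every isotropic vector of the norm form over `ZMod 5` lies in one of the six right ideals
generated by `1 ± 2i`, `1 ± 2j`, `1 ± 2k`. -/
theorem isotropic_zmod_five : ∀ a b c d : ZMod 5, a ^ 2 + b ^ 2 + c ^ 2 + d ^ 2 = 0 →
    (a + 2 * b = 0 ∧ c + 2 * d = 0) ∨ (a - 2 * b = 0 ∧ c - 2 * d = 0) ∨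
    (a + 2 * c = 0 ∧ b - 2 * d = 0) ∨ (a - 2 * c = 0 ∧ b + 2 * d = 0) ∨
    (a + 2 * d = 0 ∧ b + 2 * c = 0) ∨ (a - 2 * d = 0 ∧ b - 2 * c = 0) := by
  decide

theorem exists_eq_mul_of_five_dvd_quatNorm {p : ℍ[ℤ]} (hp : 5 ∣ quatNorm p) :
    ∃ g ∈ genSet, quatNorm g = 5 ∧ ∃ q, p = g * q := by
  obtain ⟨a, b, c, d⟩ := p
  have key := isotropic_zmod_five a b c d
    (by simpa [quatNorm] using (ZMod.intCast_zmod_eq_zero_iff_dvd _ 5).2 hp)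
  have dvd {x : ℤ} (hx : (x : ZMod 5) = 0) : ∃ s, x = 5 * s :=
    (ZMod.intCast_zmod_eq_zero_iff_dvd x 5).1 hx
  rcases key with ⟨h, h'⟩ | ⟨h, h'⟩ | ⟨h, h'⟩ | ⟨h, h'⟩ | ⟨h, h'⟩ | ⟨h, h'⟩
  · obtain ⟨s, hs⟩ := dvd (x := a + 2 * b) (mod_cast h)
    obtain ⟨t, ht⟩ := dvd (x := c + 2 * d) (mod_cast h')
    refine ⟨1 + 2 * qi, by simp [genSet], rfl, ⟨s, b - 2 * s, t, d - 2 * t⟩, ?_⟩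
    change _ = (⟨1, 2, 0, 0⟩ * ⟨s, b - 2 * s, t, d - 2 * t⟩ : ℍ[ℤ])
    rw [mk_mul_mk]
    congr 1 <;> linarith
  · obtain ⟨s, hs⟩ := dvd (x := a - 2 * b) (mod_cast h)
    obtain ⟨t, ht⟩ := dvd (x := c - 2 * d) (mod_cast h')
    refine ⟨1 - 2 * qi, by simp [genSet], rfl, ⟨s, b + 2 * s, t, d + 2 * t⟩, ?_⟩
    change _ = (⟨1, -2, 0, 0⟩ * ⟨s, b + 2 * s, t, d + 2 * t⟩ : ℍ[ℤ])
    rw [mk_mul_mk]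
    congr 1 <;> linarith
  · obtain ⟨s, hs⟩ := dvd (x := a + 2 * c) (mod_cast h)
    obtain ⟨t, ht⟩ := dvd (x := b - 2 * d) (mod_cast h')
    refine ⟨1 + 2 * qj, by simp [genSet], rfl, ⟨s, t, c - 2 * s, d + 2 * t⟩, ?_⟩
    change _ = (⟨1, 0, 2, 0⟩ * ⟨s, t, c - 2 * s, d + 2 * t⟩ : ℍ[ℤ])
    rw [mk_mul_mk]
    congr 1 <;> linarith
  · obtain ⟨s, hs⟩ := dvd (x := a - 2 * c) (mod_cast h)
    obtain ⟨t, ht⟩ := dvd (x := b + 2 * d) (mod_cast h')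
    refine ⟨1 - 2 * qj, by simp [genSet], rfl, ⟨s, t, c + 2 * s, d - 2 * t⟩, ?_⟩
    change _ = (⟨1, 0, -2, 0⟩ * ⟨s, t, c + 2 * s, d - 2 * t⟩ : ℍ[ℤ])
    rw [mk_mul_mk]
    congr 1 <;> linarith
  · obtain ⟨s, hs⟩ := dvd (x := a + 2 * d) (mod_cast h)
    obtain ⟨t, ht⟩ := dvd (x := b + 2 * c) (mod_cast h')
    refine ⟨1 + 2 * qk, by simp [genSet], rfl, ⟨s, t, c - 2 * t, d - 2 * s⟩, ?_⟩
    change _ = (⟨1, 0, 0, 2⟩ * ⟨s, t, c - 2 * t, d - 2 * s⟩ : ℍ[ℤ])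
    rw [mk_mul_mk]
    congr 1 <;> linarith
  · obtain ⟨s, hs⟩ := dvd (x := a - 2 * d) (mod_cast h)
    obtain ⟨t, ht⟩ := dvd (x := b - 2 * c) (mod_cast h')
    refine ⟨1 - 2 * qk, by simp [genSet], rfl, ⟨s, t, c + 2 * t, d + 2 * s⟩, ?_⟩
    change _ = (⟨1, 0, 0, -2⟩ * ⟨s, t, c + 2 * t, d + 2 * s⟩ : ℍ[ℤ])
    rw [mk_mul_mk]
    congr 1 <;> linarith

/-- The submonoid `U` of the integer quaternions generated by
`{±1, ±i, ±j, ±k, 1+2i, 1−2i, 1+2j, 1−2j, 1+2k, 1−2k}` equals the set of all integer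
quaternions whose norm is a power `5^l` of `5` for some `l ≥ 0`. -/
theorem closure_eq_norm_pow_five :
    (Submonoid.closure genSet : Set ℍ[ℤ]) = {p : ℍ[ℤ] | ∃ l : ℕ, quatNorm p = 5 ^ l} := by
  ext p
  simp only [SetLike.mem_coe, Set.mem_ofPred_eq]
  constructor
  · intro hp
    induction hp using Submonoid.closure_induction with
    | mem g hg => exact exists_quatNorm_eq_pow_of_mem_genSet hg
    | one => exact ⟨0, rfl⟩
    | mul p q _ _ hp hq =>
      obtain ⟨l, hl⟩ := hp
      obtain ⟨m, hm⟩ := hq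
      exact ⟨l + m, by rw [quatNorm_mul, hl, hm, pow_add]⟩
  · rintro ⟨l, hl⟩
    induction l generalizing p with
    | zero => exact Submonoid.subset_closure (mem_genSet_of_quatNorm_eq_one (by simpa using hl))
    | succ l ih =>
      obtain ⟨g, hg, hg5, q, rfl⟩ := exists_eq_mul_of_five_dvd_quatNorm (p := p)
        (hl ▸ Dvd.intro_left _ (pow_succ 5 l).symm)
      refine mul_mem (Submonoid.subset_closure hg) (ih q ?_)
      rw [quatNorm_mul, hg5, pow_succ'] at hl
      exact mul_left_cancel₀ (by norm_num) hl
end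

section
/- Let t ≥ 1 be an integer and let y ∈ ℤ⁴ be nonzero. Then there exists a point z on the unit sphere S³ ⊂ ℝ⁴ such that the ball of radius 1/(20t·(|y|·5^{t/2})^{1/2}) around z with respect to the metric d(u,v) = sqrt(1 − |⟨u,v⟩|) is contained in the ball of radius 1/(√2·(5^t·|y|²)^{1/4}) around y/|y|, and this smaller ball contains no point of the form x/|x| with x ∈ ℤ⁴ satisfying |x|² = 5^h for some integer 0 ≤ h ≤ t. -/
/-- The distance `d(u,v) = sqrt(1 − |⟨u,v⟩|)` on the unit sphere `S³ ⊂ ℝ⁴`. -/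
noncomputable def dS (u v : Fin 4 → ℝ) : ℝ := Real.sqrt (1 - |∑ i, u i * v i|)

/-- The Euclidean norm of an integer vector in `ℤ⁴`. -/
noncomputable def nrmZ (y : Fin 4 → ℤ) : ℝ := Real.sqrt (∑ i, (y i : ℝ) ^ 2)

/-- The ball of radius `r` around `z` inside the unit sphere `S³`, with respect to `dS`. -/
def ballS (z : Fin 4 → ℝ) (r : ℝ) : Set (Fin 4 → ℝ) :=
  {u | ∑ i, u i ^ 2 = 1 ∧ dS z u < r}

theorem dS_eq_min_norm (u v : Fin 4 → ℝ) (hu : ∑ i, u i ^ 2 = 1) (hv : ∑ i, v i ^ 2 = 1) :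
    dS u v = min ‖WithLp.toLp 2 u - WithLp.toLp 2 v‖ ‖WithLp.toLp 2 u + WithLp.toLp 2 v‖ / √2 := by
  have hsub : ‖WithLp.toLp 2 u - WithLp.toLp 2 v‖ = √(2 * (1 - ∑ i, u i * v i)) := by
    rw [EuclideanSpace.norm_eq]
    congr 1
    simp only [PiLp.sub_apply, Real.norm_eq_abs, sq_abs, Fin.sum_univ_four] at *
    linarith
  have hadd : ‖WithLp.toLp 2 u + WithLp.toLp 2 v‖ = √(2 * (1 + ∑ i, u i * v i)) := by
    rw [EuclideanSpace.norm_eq]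
    congr 1
    simp only [PiLp.add_apply, Real.norm_eq_abs, sq_abs, Fin.sum_univ_four] at *
    linarith
  have hmin : min (2 * (1 - ∑ i, u i * v i)) (2 * (1 + ∑ i, u i * v i)) =
      (1 - |∑ i, u i * v i|) * 2 := by
    rcases abs_cases (∑ i, u i * v i) with ⟨h, _⟩ | ⟨h, _⟩ <;> rw [h]
    · rw [min_eq_left] <;> linarith
    · rw [min_eq_right] <;> linarith
  rw [hsub, hadd, ← Real.sqrt_monotone.map_min, hmin, Real.sqrt_mul' _ zero_le_two,
    mul_div_cancel_right₀ _ (by positivity), dS]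

theorem dS_triangle (u v w : Fin 4 → ℝ) (hu : ∑ i, u i ^ 2 = 1) (hv : ∑ i, v i ^ 2 = 1)
    (hw : ∑ i, w i ^ 2 = 1) : dS u w ≤ dS u v + dS v w := by
  rw [dS_eq_min_norm u w hu hw, dS_eq_min_norm u v hu hv, dS_eq_min_norm v w hv hw, ← add_div]
  gcongr
  generalize WithLp.toLp 2 u = a
  generalize WithLp.toLp 2 v = b
  generalize WithLp.toLp 2 w = c
  have h₁ : ‖a - c‖ ≤ ‖a - b‖ + ‖b - c‖ := norm_sub_le_norm_sub_add_norm_sub a b c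
  have h₂ : ‖a + c‖ ≤ ‖a - b‖ + ‖b + c‖ := by
    rw [show a + c = a - b + (b + c) by abel]
    exact norm_add_le _ _
  have h₃ : ‖a + c‖ ≤ ‖a + b‖ + ‖b - c‖ := by
    rw [show a + c = a + b - (b - c) by abel]
    exact norm_sub_le _ _
  have h₄ : ‖a - c‖ ≤ ‖a + b‖ + ‖b + c‖ := by
    rw [show a - c = a + b - (b + c) by abel]
    exact norm_sub_le _ _
  grind

theorem dS_comm (u v : Fin 4 → ℝ) : dS u v = dS v u := by
  simp only [dS, mul_comm]

theorem exists_unit_dS_eq (e : Fin 4 → ℝ) (he : ∑ i, e i ^ 2 = 1) {ρ : ℝ} (h₀ : 0 ≤ ρ)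
    (h₁ : ρ ≤ 1) : ∃ z : Fin 4 → ℝ, ∑ i, z i ^ 2 = 1 ∧ dS e z = ρ := by
  obtain ⟨c, hc⟩ : ∃ c, c = 1 - ρ ^ 2 := ⟨_, rfl⟩
  have hc₀ : 0 ≤ c := by nlinarith
  obtain ⟨s, hs⟩ : ∃ s : ℝ, s ^ 2 = 1 - c ^ 2 := ⟨√(1 - c ^ 2), Real.sq_sqrt (by nlinarith)⟩
  rw [Fin.sum_univ_four] at he
  refine ⟨![c * e 0 - s * e 1, c * e 1 + s * e 0, c * e 2 - s * e 3, c * e 3 + s * e 2], ?_, ?_⟩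
  · simp [Fin.sum_univ_four]
    linear_combination (c ^ 2 + s ^ 2) * he + hs
  · have : ∑ i, e i * ![c * e 0 - s * e 1, c * e 1 + s * e 0, c * e 2 - s * e 3,
        c * e 3 + s * e 2] i = c := by
      simp [Fin.sum_univ_four]
      linear_combination c * he
    rw [dS, this, abs_of_nonneg hc₀, hc, sub_sub_cancel, Real.sqrt_sq h₀]

theorem nrmZ_pos {y : Fin 4 → ℤ} (hy : y ≠ 0) : 0 < nrmZ y := by
  obtain ⟨i, hi⟩ := Function.ne_iff.mp hy
  refine Real.sqrt_pos.mpr (Finset.sum_pos' (fun _ _ => sq_nonneg _) ⟨i, Finset.mem_univ i, ?_⟩)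
  have : (y i : ℝ) ≠ 0 := by exact_mod_cast hi
  positivity

theorem one_le_nrmZ {y : Fin 4 → ℤ} (hy : y ≠ 0) : 1 ≤ nrmZ y := by
  have h := Real.sqrt_pos.mp (nrmZ_pos hy)
  refine Real.one_le_sqrt.mpr ?_
  exact_mod_cast (show (0 : ℤ) < ∑ i, y i ^ 2 by exact_mod_cast h)

theorem sum_div_nrmZ_sq {y : Fin 4 → ℤ} (hy : y ≠ 0) :
    ∑ i, ((y i : ℝ) / nrmZ y) ^ 2 = 1 := by
  have h : nrmZ y ^ 2 = ∑ i, (y i : ℝ) ^ 2 := Real.sq_sqrt (by positivity)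
  simp only [div_pow]
  rw [← Finset.sum_div, ← h]
  exact div_self (pow_ne_zero 2 (nrmZ_pos hy).ne')

theorem dS_div_nrmZ (x y : Fin 4 → ℤ) :
    dS (fun i => (y i : ℝ) / nrmZ y) (fun i => (x i : ℝ) / nrmZ x) =
      √(1 - (|∑ i, y i * x i| : ℤ) / (nrmZ y * nrmZ x)) := by
  have : ∑ i, (y i : ℝ) / nrmZ y * ((x i : ℝ) / nrmZ x) =
      ((∑ i, y i * x i : ℤ) : ℝ) / (nrmZ y * nrmZ x) := by
    push_cast
    rw [Finset.sum_div]
    exact Finset.sum_congr rfl fun i _ => by rw [div_mul_div_comm]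
  have hn : 0 ≤ nrmZ y * nrmZ x := mul_nonneg (Real.sqrt_nonneg _) (Real.sqrt_nonneg _)
  rw [dS, this, abs_div, abs_of_nonneg hn, Int.cast_abs]

theorem abs_inner_le_nrmZ_mul (x y : Fin 4 → ℤ) :
    ((|∑ i, y i * x i| : ℤ) : ℝ) ≤ nrmZ y * nrmZ x := by
  have h := Finset.sum_mul_sq_le_sq_mul_sq Finset.univ (fun i => (y i : ℝ)) (fun i => (x i : ℝ))
  rw [nrmZ, nrmZ, ← Real.sqrt_mul (by positivity)]
  refine Real.le_sqrt_of_sq_le ?_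
  push_cast
  rwa [sq_abs]

/-- Integer vectors of a common norm which are close in direction to `y` all lie at the same
distance from `y / |y|`. -/
theorem dS_eq_of_nrmZ_eq {x x' y : Fin 4 → ℤ} (hx : x ≠ 0) (hy : y ≠ 0) (hxx' : nrmZ x = nrmZ x')
    {R : ℝ} (hR : R ^ 2 * (nrmZ y * nrmZ x) ≤ 1 / 2)
    (h : dS (fun i => (y i : ℝ) / nrmZ y) (fun i => (x i : ℝ) / nrmZ x) < R)
    (h' : dS (fun i => (y i : ℝ) / nrmZ y) (fun i => (x' i : ℝ) / nrmZ x') < R) :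
    dS (fun i => (y i : ℝ) / nrmZ y) (fun i => (x i : ℝ) / nrmZ x) =
      dS (fun i => (y i : ℝ) / nrmZ y) (fun i => (x' i : ℝ) / nrmZ x') := by
  have hR₀ : 0 < R := (Real.sqrt_nonneg _).trans_lt h
  have hA : 0 < nrmZ y * nrmZ x := mul_pos (nrmZ_pos hy) (nrmZ_pos hx)
  have hle := abs_inner_le_nrmZ_mul x y
  have hle' := abs_inner_le_nrmZ_mul x' y
  rw [dS_div_nrmZ] at h h' ⊢
  rw [dS_div_nrmZ]
  rw [← hxx'] at hle' h' ⊢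
  generalize nrmZ y * nrmZ x = A at *
  generalize |∑ i, y i * x i| = k at *
  generalize |∑ i, y i * x' i| = k' at *
  have aux : ∀ m : ℤ, √(1 - (m : ℝ) / A) < R → A - 1 / 2 < m := by
    intro m hm
    rw [Real.sqrt_lt' hR₀, sub_lt_comm, lt_div_iff₀ hA] at hm
    linarith
  have hk := aux k h
  have hk' := aux k' h'
  have h₁ : k < k' + 1 := by exact_mod_cast (by linarith : (k : ℝ) < k' + 1)
  have h₂ : k' < k + 1 := by exact_mod_cast (by linarith : (k' : ℝ) < k + 1)
  rw [show k = k' by omega]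

theorem nrmZ_eq_of_sum_sq {x : Fin 4 → ℤ} {n : ℤ} (h : ∑ i, x i ^ 2 = n) : nrmZ x = √n := by
  rw [nrmZ, ← h]
  push_cast
  rfl

theorem ne_zero_of_sum_sq_eq_pow {x : Fin 4 → ℤ} {h : ℕ} (hx : ∑ i, x i ^ 2 = 5 ^ h) :
    x ≠ 0 := by
  rintro rfl
  simp at hx
  exact absurd hx.symm (by positivity)

/-- Let `t ≥ 1` and let `y ∈ ℤ⁴` be nonzero.  Then there is a point `z ∈ S³` such that the
ball of radius `1/(20t·(|y|·5^(t/2))^(1/2))` around `z` is contained in the ball of radius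
`1/(√2·(5^t·|y|²)^(1/4))` around `y/|y|`, and the smaller ball contains no point `x/|x|`
with `x ∈ ℤ⁴` and `|x|² = 5^h` for some `0 ≤ h ≤ t`. -/
theorem exists_ball_avoiding_solutions (t : ℕ) (ht : 1 ≤ t) (y : Fin 4 → ℤ) (hy : y ≠ 0) :
    ∃ z : Fin 4 → ℝ, (∑ i, z i ^ 2) = 1 ∧
      ballS z (1 / (20 * t * Real.sqrt (nrmZ y * Real.sqrt (5 ^ t)))) ⊆
        ballS (fun i => (y i : ℝ) / nrmZ y)
          (1 / (Real.sqrt 2 * ((5 ^ t * nrmZ y ^ 2 : ℝ) ^ ((1 : ℝ) / 4)))) ∧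
      ∀ x : Fin 4 → ℤ, (∃ h : ℕ, h ≤ t ∧ (∑ i, x i ^ 2) = 5 ^ h) →
        (fun i => (x i : ℝ) / nrmZ x) ∉
          ballS z (1 / (20 * t * Real.sqrt (nrmZ y * Real.sqrt (5 ^ t)))) := by
  have hN := one_le_nrmZ hy
  have hN₀ := nrmZ_pos hy
  have hQ : 1 ≤ √((5 : ℝ) ^ t) := Real.one_le_sqrt.mpr (one_le_pow₀ (by norm_num))
  obtain ⟨T, hT⟩ : ∃ T, T = nrmZ y * √((5 : ℝ) ^ t) := ⟨_, rfl⟩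
  have hT₁ : 1 ≤ T := hT ▸ one_le_mul_of_one_le_of_one_le hN hQ
  have hTsq : T ^ 2 = 5 ^ t * nrmZ y ^ 2 := by
    rw [hT, mul_pow, Real.sq_sqrt (by positivity), mul_comm]
  have hquarter : (5 ^ t * nrmZ y ^ 2 : ℝ) ^ ((1 : ℝ) / 4) = √T := by
    rw [← hTsq, ← Real.rpow_natCast, ← Real.rpow_mul (by linarith), Real.sqrt_eq_rpow]
    norm_num
  rw [hquarter, ← hT]
  have ht₁ : (1 : ℝ) ≤ t := by exact_mod_cast ht
  have hsT : 1 ≤ √T := Real.one_le_sqrt.mpr hT₁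
  obtain ⟨R, hR⟩ : ∃ R, R = 1 / (√2 * √T) := ⟨_, rfl⟩
  obtain ⟨r, hr⟩ : ∃ r, r = 1 / (20 * t * √T) := ⟨_, rfl⟩
  have hRsq : R ^ 2 * T = 1 / 2 := by
    rw [hR, div_pow, mul_pow, Real.sq_sqrt (by norm_num), Real.sq_sqrt (by linarith)]
    field_simp
  have hr₀ : 0 < r := by rw [hr]; positivity
  have hR₀ : 0 < R := by rw [hR]; positivity
  have hR₁ : R ≤ 1 := by nlinarith
  have hrR : (2 * t + 4) * r ≤ R := by
    have hs₂ : √2 ≤ 2 := by rw [Real.sqrt_le_left (by norm_num)]; norm_num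
    have hrt : t * r = 1 / (20 * √T) := by rw [hr]; field_simp
    have hR₂ : 1 / (2 * √T) ≤ R := by rw [hR]; gcongr
    have : 1 / (2 * √T) = 10 * (1 / (20 * √T)) := by field_simp; norm_num
    nlinarith
  rw [← hr, ← hR]
  set e : Fin 4 → ℝ := fun i => (y i : ℝ) / nrmZ y with he
  have he₁ : ∑ i, e i ^ 2 = 1 := sum_div_nrmZ_sq hy
  obtain ⟨j, hj, hgap⟩ : ∃ j ∈ Finset.range (t + 2), ∀ x : Fin 4 → ℤ, ∀ h ≤ t,
      ∑ i, x i ^ 2 = 5 ^ h → r ≤ |dS e (fun i => (x i : ℝ) / nrmZ x) - (2 * j + 1) * r| := by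
    by_contra! hcon
    choose! x h hht hx hclose using hcon
    obtain ⟨j, hj, j', hj', hne, heq⟩ := Finset.exists_ne_map_eq_of_card_lt_of_maps_to
      (s := Finset.range (t + 2)) (t := Finset.range (t + 1)) (f := h) (by simp)
      (fun j hj => by have := hht j hj; simp at *; omega)
    have hlt : ∀ j ∈ Finset.range (t + 2), dS e (fun i => (x j i : ℝ) / nrmZ (x j)) < R := by
      intro j hj
      have hjt : (j : ℝ) ≤ t + 1 := by
        exact_mod_cast Nat.lt_succ_iff.mp (Finset.mem_range.mp hj)
      have := (abs_lt.mp (hclose j hj)).2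
      nlinarith
    have hnorm : ∀ j ∈ Finset.range (t + 2), nrmZ (x j) = √((5 : ℝ) ^ h j) := by
      intro j hj
      rw [nrmZ_eq_of_sum_sq (hx j hj)]
      push_cast
      rfl
    have hdist := dS_eq_of_nrmZ_eq (ne_zero_of_sum_sq_eq_pow (hx j hj)) hy
      (by rw [hnorm j hj, hnorm j' hj', heq]) (R := R) (by
        rw [← hRsq, hT, hnorm j hj]
        gcongr
        · norm_num
        · exact hht j hj) (hlt j hj) (hlt j' hj')
    have hc := abs_lt.mp (hclose j hj)
    have hc' := abs_lt.mp (hclose j' hj')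
    rw [← he] at hdist
    rw [hdist] at hc
    have h₁ : (j : ℝ) < j' + 1 := by nlinarith
    have h₂ : (j' : ℝ) < j + 1 := by nlinarith
    norm_cast at h₁ h₂
    omega
  have hjt : (j : ℝ) ≤ t + 1 := by
    exact_mod_cast Nat.lt_succ_iff.mp (Finset.mem_range.mp hj)
  have hρR : (2 * j + 1) * r + r ≤ R := by nlinarith
  obtain ⟨z, hz, hdz⟩ := exists_unit_dS_eq e he₁ (ρ := (2 * j + 1) * r) (by positivity)
    (by linarith)
  refine ⟨z, hz, ?_, ?_⟩
  · rintro u ⟨hu, hdu⟩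
    refine ⟨hu, ?_⟩
    linarith [dS_triangle e z u he₁ hz hu]
  · rintro x ⟨h, hht, hx⟩ ⟨hu, hdu⟩
    refine (hgap x h hht hx).not_gt (abs_lt.mpr ⟨?_, ?_⟩)
    · have := dS_triangle e _ z he₁ hu hz
      rw [dS_comm (fun i => (x i : ℝ) / nrmZ x) z] at this
      linarith
    · linarith [dS_triangle e z _ he₁ hz hu]
end
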